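/- Differential inequality for power moments: let (u,m) be a smooth solution of the first-order planning system with m > 0 on [0,T]×𝕋^d, and let s ≥ 1. Then the function f(t) = ∫_{𝕋^d} m(t,x)^s dx satisfies f''(t) ≥ −(s−1) ‖ΔV‖_{L^∞([0,T]×𝕋^d)} f(t) for all t ∈ (0,T). -/

import Mathlib

open MeasureTheory Real Set

/-- Partial derivative in the `i`-th coordinate direction. -/
noncomputable def pd {d : ℕ} (i : Fin d) (f : (Fin d → ℝ) → ℝ) (x : Fin d → ℝ) : ℝ :=
  fderiv ℝ f x (Pi.single i 1)

/-- Laplacian in the space variable. -/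
noncomputable def lap {d : ℕ} (f : (Fin d → ℝ) → ℝ) (x : Fin d → ℝ) : ℝ :=
  ∑ i, pd i (pd i f) x

/-- The `L^∞` norm of `ΔV` on `[0,T] × 𝕋^d` (for continuous periodic `V`, the sup of `|ΔV|`). -/
noncomputable def lapVsup (d : ℕ) (T : ℝ) (V : ℝ → (Fin d → ℝ) → ℝ) : ℝ :=
  sSup {y : ℝ | ∃ t ∈ Set.Icc (0 : ℝ) T, ∃ x : Fin d → ℝ, y = |lap (V t) x|}

open scoped ContDiff

/-- Directional derivative of a space-time function. -/
noncomputable def Dd {d : ℕ} (v : ℝ × (Fin d → ℝ)) (F : ℝ × (Fin d → ℝ) → ℝ)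
    (q : ℝ × (Fin d → ℝ)) : ℝ := fderiv ℝ F q v

/-- Spatial direction. -/
noncomputable def ex {d : ℕ} (i : Fin d) : ℝ × (Fin d → ℝ) := (0, Pi.single i 1)

/-- Open slab. -/
def Slab (T : ℝ) (d : ℕ) : Set (ℝ × (Fin d → ℝ)) := Set.Ioo (0 : ℝ) T ×ˢ Set.univ

/-- Smooth on the slab. -/
def Sm (T : ℝ) {d : ℕ} (F : ℝ × (Fin d → ℝ) → ℝ) : Prop := ContDiffOn ℝ ∞ F (Slab T d)

/-- Periodic in space. -/
def Per {d : ℕ} (F : ℝ × (Fin d → ℝ) → ℝ) : Prop :=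
  ∀ (q : ℝ × (Fin d → ℝ)) (k : Fin d → ℤ), F (q + (0, fun i => (k i : ℝ))) = F q

lemma slab_open (T : ℝ) (d : ℕ) : IsOpen (Slab T d) := isOpen_Ioo.prod isOpen_univ

section
variable {T : ℝ} {d : ℕ} {F G : ℝ × (Fin d → ℝ) → ℝ} {q v w : ℝ × (Fin d → ℝ)}

lemma Sm.at (h : Sm T F) (hq : q ∈ Slab T d) : ContDiffAt ℝ ∞ F q :=
  h.contDiffAt ((slab_open T d).mem_nhds hq)

lemma Sm.diff (h : Sm T F) (hq : q ∈ Slab T d) : DifferentiableAt ℝ F q :=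
  (h.at hq).differentiableAt (by simp)

lemma Sm.Dd (h : Sm T F) (v : ℝ × (Fin d → ℝ)) : Sm T (Dd v F) := by
  have := ContDiffOn.fderiv_of_isOpen (m := ∞) h (slab_open T d) (by simp)
  exact this.clm_apply contDiffOn_const

lemma Sm.mul (h : Sm T F) (h' : Sm T G) : Sm T (fun q => F q * G q) := ContDiffOn.mul h h'
lemma Sm.add (h : Sm T F) (h' : Sm T G) : Sm T (fun q => F q + G q) := ContDiffOn.add h h'
lemma Sm.sub (h : Sm T F) (h' : Sm T G) : Sm T (fun q => F q - G q) := ContDiffOn.sub h h'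
lemma Sm.sum {H : Fin d → ℝ × (Fin d → ℝ) → ℝ} (h : ∀ i, Sm T (H i)) :
    Sm T (fun q => ∑ i, H i q) := ContDiffOn.sum fun i _ => h i

lemma Per.mul (h : Per F) (h' : Per G) : Per (fun q => F q * G q) := fun q k => by
  simp only [h q k, h' q k]
lemma Per.sub (h : Per F) (h' : Per G) : Per (fun q => F q - G q) := fun q k => by
  simp only [h q k, h' q k]
lemma Per.sum {H : Fin d → ℝ × (Fin d → ℝ) → ℝ} (h : ∀ i, Per (H i)) :
    Per (fun q => ∑ i, H i q) := fun q k => by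
  simp only [fun i => h i q k]
lemma Per.comp (h : Per F) (φ : ℝ → ℝ) : Per (fun q => φ (F q)) := fun q k => by
  simp only [h q k]
lemma Per.Dd (h : Per F) (v : ℝ × (Fin d → ℝ)) : Per (Dd v F) := fun q k => by
  unfold _root_.Dd
  rw [← fderiv_comp_add_right]
  congr 2
  funext q
  exact h q k

lemma Dd_congr (h : ∀ q ∈ Slab T d, F q = G q) (hq : q ∈ Slab T d) : Dd v F q = Dd v G q := by
  unfold Dd
  rw [Filter.EventuallyEq.fderiv_eq]
  filter_upwards [(slab_open T d).mem_nhds hq] with x hx using h x hx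

lemma Dd_mul (h : Sm T F) (h' : Sm T G) (hq : q ∈ Slab T d) :
    Dd v (fun q => F q * G q) q = Dd v F q * G q + F q * Dd v G q := by
  unfold Dd
  rw [((h.diff hq).hasFDerivAt.fun_mul (h'.diff hq).hasFDerivAt).fderiv]
  simp; ring

lemma Dd_add (h : Sm T F) (h' : Sm T G) (hq : q ∈ Slab T d) :
    Dd v (fun q => F q + G q) q = Dd v F q + Dd v G q := by
  unfold Dd
  rw [((h.diff hq).hasFDerivAt.fun_add (h'.diff hq).hasFDerivAt).fderiv]
  simp

lemma Dd_sub (h : Sm T F) (h' : Sm T G) (hq : q ∈ Slab T d) :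
    Dd v (fun q => F q - G q) q = Dd v F q - Dd v G q := by
  unfold Dd
  rw [((h.diff hq).hasFDerivAt.fun_sub (h'.diff hq).hasFDerivAt).fderiv]
  simp

lemma Dd_sum {H : Fin d → ℝ × (Fin d → ℝ) → ℝ} (h : ∀ i, Sm T (H i)) (hq : q ∈ Slab T d) :
    Dd v (fun q => ∑ i, H i q) q = ∑ i, Dd v (H i) q := by
  unfold Dd
  rw [(HasFDerivAt.fun_sum (u := Finset.univ) fun i _ => ((h i).diff hq).hasFDerivAt).fderiv]
  simp

lemma Dd_comp {φ : ℝ → ℝ} (h : Sm T F) (hq : q ∈ Slab T d) (hφ : DifferentiableAt ℝ φ (F q)) :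
    Dd v (fun q => φ (F q)) q = deriv φ (F q) * Dd v F q := by
  unfold Dd
  have := hφ.hasDerivAt.comp_hasFDerivAt q (h.diff hq).hasFDerivAt
  rw [show (fun q => φ (F q)) = φ ∘ F from rfl, this.fderiv]
  simp

lemma Dd_comm (h : Sm T F) (hq : q ∈ Slab T d) : Dd v (Dd w F) q = Dd w (Dd v F) q := by
  have hs := (h.at hq).isSymmSndFDerivAt (by simp; exact WithTop.coe_le_coe.2 (le_top : (2 : ℕ∞) ≤ ⊤))
  have hd : DifferentiableAt ℝ (fderiv ℝ F) q :=
    ((h.at hq).fderiv_right (m := ∞) (by simp)).differentiableAt (by simp)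
  have key : ∀ v w, Dd v (Dd w F) q = fderiv ℝ (fderiv ℝ F) q v w := by
    intro v w
    unfold Dd
    rw [(hd.hasFDerivAt.clm_apply (hasFDerivAt_const w q)).fderiv]
    simp
  rw [key, key, hs.eq]

lemma slice_hasFDerivAt {t : ℝ} {x : Fin d → ℝ} (hd : DifferentiableAt ℝ F (t, x)) :
    HasFDerivAt (fun y => F (t, y)) ((fderiv ℝ F (t, x)).comp (ContinuousLinearMap.inr ℝ ℝ _)) x := 
  hd.hasFDerivAt.comp x (hasFDerivAt_prodMk_right t x)

lemma pd_eq {t : ℝ} {x : Fin d → ℝ} (h : Sm T F) (hq : (t, x) ∈ Slab T d) (i : Fin d) :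
    pd i (fun y => F (t, y)) x = Dd (ex i) F (t, x) := by
  unfold pd Dd ex
  rw [(slice_hasFDerivAt (h.diff hq)).fderiv]
  simp

lemma time_hasDerivAt {t : ℝ} {x : Fin d → ℝ} (h : Sm T F) (hq : (t, x) ∈ Slab T d) :
    HasDerivAt (fun s => F (s, x)) (Dd (1, 0) F (t, x)) t := by
  have h1 : HasFDerivAt F (fderiv ℝ F (t, x)) (t, x) := (h.diff hq).hasFDerivAt
  have h2 : HasDerivAt (fun s : ℝ => (s, x)) ((1 : ℝ), (0 : Fin d → ℝ)) t :=
    (hasDerivAt_id t).prodMk (hasDerivAt_const t x)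
  exact h1.comp_hasDerivAt t h2

lemma slice_cont {t : ℝ} (h : Sm T F) (ht : t ∈ Set.Ioo 0 T) :
    Continuous (fun y : Fin d → ℝ => F (t, y)) := by
  refine (ContDiffOn.continuousOn h).comp_continuous (by fun_prop) fun y => ⟨ht, trivial⟩

lemma slice_int {t : ℝ} (h : Sm T F) (ht : t ∈ Set.Ioo 0 T) :
    IntegrableOn (fun y : Fin d → ℝ => F (t, y)) (Set.Icc 0 1) :=
  (slice_cont h ht).continuousOn.integrableOn_compact isCompact_Icc

lemma deriv_int {t : ℝ} (h : Sm T F) (ht : t ∈ Set.Ioo 0 T) :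
    HasDerivAt (fun t => ∫ x in Set.Icc (0 : Fin d → ℝ) 1, F (t, x))
      (∫ x in Set.Icc (0 : Fin d → ℝ) 1, Dd (1, 0) F (t, x)) t := by
  obtain ⟨a, ha⟩ := exists_between ht.1
  obtain ⟨b, hb⟩ := exists_between ht.2
  have hsub : Set.Icc a b ×ˢ Set.Icc (0 : Fin d → ℝ) 1 ⊆ Slab T d := fun q hq =>
    ⟨⟨ha.1.trans_le hq.1.1, hq.1.2.trans_lt hb.2⟩, trivial⟩
  obtain ⟨C, hC⟩ := (isCompact_Icc.prod isCompact_Icc).exists_bound_of_continuousOn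
    ((ContDiffOn.continuousOn (h.Dd (1, 0))).mono hsub)
  refine (hasDerivAt_integral_of_dominated_loc_of_deriv_le (bound := fun _ => C)
    (F := fun t x => F (t, x)) (F' := fun t x => Dd (1, 0) F (t, x))
    (Icc_mem_nhds ha.2 hb.1) ?_ (slice_int h ht)
    (slice_int (h.Dd _) ht).aestronglyMeasurable ?_ ?_ ?_).2
  · filter_upwards [isOpen_Ioo.mem_nhds ht] with r hr using (slice_int h hr).aestronglyMeasurable
  · filter_upwards [ae_restrict_mem measurableSet_Icc] with x hx r hr using hC _ ⟨hr, hx⟩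
  · exact (continuous_const.continuousOn).integrableOn_compact isCompact_Icc
  · refine Filter.Eventually.of_forall fun x r hr => time_hasDerivAt h ?_
    exact ⟨⟨ha.1.trans_le hr.1, hr.2.trans_lt hb.2⟩, trivial⟩

lemma div_int (hd : 1 ≤ d) {H : Fin d → ℝ × (Fin d → ℝ) → ℝ} (h : ∀ i, Sm T (H i))
    (hp : ∀ i, Per (H i)) {t : ℝ} (ht : t ∈ Set.Ioo 0 T) :
    ∫ x in Set.Icc (0 : Fin d → ℝ) 1, ∑ i, Dd (ex i) (H i) (t, x) = 0 := by
  obtain ⟨n, rfl⟩ : ∃ n, d = n + 1 := ⟨d - 1, by omega⟩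
  have hq : ∀ x, (t, x) ∈ Slab T (n + 1) := fun x => ⟨ht, trivial⟩
  have key := integral_divergence_of_hasFDerivAt_off_countable' (0 : Fin (n + 1) → ℝ) 1
    (fun i => by simp) (fun i x => H i (t, x))
    (fun i x => (fderiv ℝ (H i) (t, x)).comp (ContinuousLinearMap.inr ℝ ℝ _)) ∅ (by simp)
    (fun i => (slice_cont (h i) ht).continuousOn)
    (fun x _ i => slice_hasFDerivAt ((h i).diff (hq x)))
    (by
      have := slice_int (Sm.sum fun i => (h i).Dd (ex i)) ht
      simpa [Dd, ex] using this)
  have e : ∀ x, ∑ i, Dd (ex i) (H i) (t, x) = ∑ i, ((fderiv ℝ (H i) (t, x)).comp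
      (ContinuousLinearMap.inr ℝ ℝ _)) (Pi.single i 1) := fun x => by simp [Dd, ex]
  simp only [e]
  rw [key]
  refine Finset.sum_eq_zero fun i _ => ?_
  rw [sub_eq_zero]
  congr 1
  funext y
  have := hp i (t, i.insertNth 0 y) (Pi.single i 1)
  simp only [Pi.one_apply, Pi.zero_apply]
  rw [← this]
  congr 1
  ext j
  · simp
  · refine Fin.succAboveCases i ?_ (fun j => ?_) j <;> simp
end

section
variable {T : ℝ} {d : ℕ}

lemma within_pd {T : ℝ} (hT : 0 < T) {F : ℝ × (Fin d → ℝ) → ℝ}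
    (h : ContDiffOn ℝ ∞ F (Set.Icc (0 : ℝ) T ×ˢ (Set.univ : Set (Fin d → ℝ)))) (i : Fin d) :
    ∃ G : ℝ × (Fin d → ℝ) → ℝ,
      ContDiffOn ℝ ∞ G (Set.Icc (0 : ℝ) T ×ˢ (Set.univ : Set (Fin d → ℝ))) ∧
      ∀ t ∈ Set.Icc (0 : ℝ) T, pd i (fun y => F (t, y)) = fun y => G (t, y) := by
  have hU : UniqueDiffOn ℝ (Set.Icc (0 : ℝ) T ×ˢ (Set.univ : Set (Fin d → ℝ))) :=
    (uniqueDiffOn_Icc hT).prod uniqueDiffOn_univ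
  refine ⟨fun q => fderivWithin ℝ F (Set.Icc (0 : ℝ) T ×ˢ Set.univ) q (ex i),
    (h.fderivWithin (m := ∞) hU (by simp)).clm_apply contDiffOn_const, fun t ht => ?_⟩
  funext x
  have h1 := ((h.differentiableOn (by simp)) (t, x) ⟨ht, trivial⟩).hasFDerivWithinAt
  have h2 := h1.comp_hasFDerivAt x (hasFDerivAt_prodMk_right t x)
    (Filter.Eventually.of_forall fun y => ⟨ht, trivial⟩)
  have h3 : HasFDerivAt (fun y => F (t, y)) _ x := h2
  unfold pd
  rw [h3.fderiv]
  simp [ex]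

lemma pd_per {f : (Fin d → ℝ) → ℝ} {k : Fin d → ℝ} (h : ∀ x, f (x + k) = f x) (i : Fin d)
    (x : Fin d → ℝ) : pd i f (x + k) = pd i f x := by
  unfold pd
  rw [← fderiv_comp_add_right]
  congr 2
  funext q
  exact h q

lemma lap_le (hT : 0 < T) (V : ℝ → (Fin d → ℝ) → ℝ)
    (hV : ContDiffOn ℝ (⊤ : ℕ∞) (fun q : ℝ × (Fin d → ℝ) => V q.1 q.2)
      (Set.Icc (0 : ℝ) T ×ˢ (Set.univ : Set (Fin d → ℝ))))
    (hVper : ∀ (t : ℝ) (x : Fin d → ℝ) (k : Fin d → ℤ),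
      V t (x + fun i => (k i : ℝ)) = V t x) {t : ℝ} (ht : t ∈ Set.Icc 0 T) (x : Fin d → ℝ) :
    |lap (V t) x| ≤ lapVsup d T V := by
  refine le_csSup ?_ ⟨t, ht, x, rfl⟩
  choose G hG hG' using fun i => within_pd hT hV i
  choose K hK hK' using fun i => within_pd hT (hG i) i
  have hlap : ∀ t ∈ Set.Icc 0 T, ∀ x, lap (V t) x = ∑ i, K i (t, x) := by
    intro t ht x
    unfold lap
    refine Finset.sum_congr rfl fun i _ => ?_
    have a := hG' i t ht
    have b := hK' i t ht
    simp only at a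
    rw [show pd i (V t) = _ from a, b]
  have hc : ContinuousOn (fun q => ∑ i, K i q) (Set.Icc (0 : ℝ) T ×ˢ Set.Icc (0 : Fin d → ℝ) 1) :=
    (ContDiffOn.continuousOn (n := ∞) (ContDiffOn.sum fun i _ => hK i)).mono
      (Set.prod_mono subset_rfl (Set.subset_univ _))
  obtain ⟨C, hC⟩ := (isCompact_Icc.prod isCompact_Icc).exists_bound_of_continuousOn hc
  refine ⟨C, ?_⟩
  rintro y ⟨r, hr, z, rfl⟩
  have hper : lap (V r) z = lap (V r) (fun i => Int.fract (z i)) := by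
    have : z = (fun i => Int.fract (z i)) + fun i => ((⌊z i⌋ : ℤ) : ℝ) := by
      funext i; simp
    conv_lhs => rw [this]
    unfold lap
    refine Finset.sum_congr rfl fun i _ => ?_
    exact pd_per (fun x => pd_per (fun x => hVper r x _) i x) i _
  rw [hper, hlap r hr]
  exact hC (r, _) ⟨hr, fun i => Int.fract_nonneg _, fun i => (Int.fract_lt_one _).le⟩
end

theorem diff_ineq_power_moments
    (T : ℝ) (hT : 0 < T) (d : ℕ) (hd : 1 ≤ d)
    (V : ℝ → (Fin d → ℝ) → ℝ)
    (hV : ContDiffOn ℝ (⊤ : ℕ∞) (fun q : ℝ × (Fin d → ℝ) => V q.1 q.2)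
      (Set.Icc (0 : ℝ) T ×ˢ (Set.univ : Set (Fin d → ℝ))))
    (hVper : ∀ (t : ℝ) (x : Fin d → ℝ) (k : Fin d → ℤ),
      V t (x + fun i => (k i : ℝ)) = V t x)
    (g : ℝ → ℝ) (hg : ContDiffOn ℝ (⊤ : ℕ∞) g (Set.Ioi 0)) (hgmono : MonotoneOn g (Set.Ioi 0))
    (m₀ mT : (Fin d → ℝ) → ℝ)
    (hm₀sm : ContDiff ℝ (⊤ : ℕ∞) m₀) (hmTsm : ContDiff ℝ (⊤ : ℕ∞) mT)
    (hm₀per : ∀ (x : Fin d → ℝ) (k : Fin d → ℤ), m₀ (x + fun i => (k i : ℝ)) = m₀ x)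
    (hmTper : ∀ (x : Fin d → ℝ) (k : Fin d → ℤ), mT (x + fun i => (k i : ℝ)) = mT x)
    (hm₀nn : ∀ x, 0 ≤ m₀ x) (hmTnn : ∀ x, 0 ≤ mT x)
    (hm₀pr : ∫ x in Set.Icc (0 : Fin d → ℝ) 1, m₀ x = 1)
    (hmTpr : ∫ x in Set.Icc (0 : Fin d → ℝ) 1, mT x = 1)
    (u m : ℝ → (Fin d → ℝ) → ℝ)
    (hu : ContDiffOn ℝ (⊤ : ℕ∞) (fun q : ℝ × (Fin d → ℝ) => u q.1 q.2)
      (Set.Icc (0 : ℝ) T ×ˢ (Set.univ : Set (Fin d → ℝ))))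
    (hm : ContDiffOn ℝ (⊤ : ℕ∞) (fun q : ℝ × (Fin d → ℝ) => m q.1 q.2)
      (Set.Icc (0 : ℝ) T ×ˢ (Set.univ : Set (Fin d → ℝ))))
    (huper : ∀ (t : ℝ) (x : Fin d → ℝ) (k : Fin d → ℤ),
      u t (x + fun i => (k i : ℝ)) = u t x)
    (hmper : ∀ (t : ℝ) (x : Fin d → ℝ) (k : Fin d → ℤ),
      m t (x + fun i => (k i : ℝ)) = m t x)
    (hmnn : ∀ t x, 0 ≤ m t x)
    (hHJ : ∀ t ∈ Set.Ioo (0 : ℝ) T, ∀ x,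
      -(deriv (fun s => u s x) t) + (∑ i, (pd i (u t) x) ^ 2) / 2 + V t x = g (m t x))
    (hFP : ∀ t ∈ Set.Ioo (0 : ℝ) T, ∀ x,
      deriv (fun s => m s x) t = ∑ i, pd i (fun y => m t y * pd i (u t) y) x)
    (hini : ∀ x, m 0 x = m₀ x) (hter : ∀ x, m T x = mT x)
    (hmpos : ∀ t ∈ Set.Icc (0 : ℝ) T, ∀ x, 0 < m t x)
    (s : ℝ) (hs : 1 ≤ s) :
    ∀ t ∈ Set.Ioo (0 : ℝ) T,
      deriv (deriv (fun t' => ∫ x in Set.Icc (0 : Fin d → ℝ) 1, m t' x ^ s)) t ≥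
        -(s - 1) * lapVsup d T V * ∫ x in Set.Icc (0 : Fin d → ℝ) 1, m t x ^ s := by
  set M : ℝ × (Fin d → ℝ) → ℝ := fun q => m q.1 q.2 with hMdef
  set U : ℝ × (Fin d → ℝ) → ℝ := fun q => u q.1 q.2 with hUdef
  set W : ℝ × (Fin d → ℝ) → ℝ := fun q => V q.1 q.2 with hWdef
  have hsub : Slab T d ⊆ Set.Icc (0 : ℝ) T ×ˢ (Set.univ : Set (Fin d → ℝ)) :=
    Set.prod_mono Set.Ioo_subset_Icc_self subset_rfl
  have sM : Sm T M := hm.mono hsub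
  have sU : Sm T U := hu.mono hsub
  have sW : Sm T W := hV.mono hsub
  have pM : Per M := fun q k => by simpa [hMdef] using hmper q.1 q.2 k
  have pU : Per U := fun q k => by simpa [hUdef] using huper q.1 q.2 k
  have posM : ∀ q ∈ Slab T d, 0 < M q := fun q hq => hmpos q.1 (hsub hq).1 q.2
  have gdiff : ∀ q ∈ Slab T d, DifferentiableAt ℝ g (M q) := fun q hq =>
    (hg.contDiffAt (isOpen_Ioi.mem_nhds (posM q hq))).differentiableAt (by simp)
  have gnn : ∀ q ∈ Slab T d, 0 ≤ deriv g (M q) := fun q hq => by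
    rw [← derivWithin_of_isOpen isOpen_Ioi (posM q hq)]
    exact hgmono.derivWithin_nonneg
  -- derived functions
  obtain ⟨P, hP⟩ : ∃ P : ℝ × (Fin d → ℝ) → ℝ, P = fun q => M q ^ s := ⟨_, rfl⟩
  obtain ⟨N, hN⟩ : ∃ N : ℝ × (Fin d → ℝ) → ℝ, N = fun q => g (M q) := ⟨_, rfl⟩
  obtain ⟨A, hA⟩ : ∃ A : Fin d → ℝ × (Fin d → ℝ) → ℝ, A = fun i => Dd (ex i) U := ⟨_, rfl⟩
  obtain ⟨L, hL⟩ : ∃ L : ℝ × (Fin d → ℝ) → ℝ, L = fun q => ∑ i, Dd (ex i) (A i) q := ⟨_, rfl⟩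
  have sP : Sm T P := hP ▸ ContDiffOn.rpow_const_of_ne sM fun q hq => (posM q hq).ne'
  have sN : Sm T N := hN ▸ hg.comp sM (fun q hq => posM q hq)
  have sA : ∀ i, Sm T (A i) := fun i => hA ▸ sU.Dd _
  have sL : Sm T L := hL ▸ Sm.sum fun i => (sA i).Dd _
  have pP : Per P := hP ▸ pM.comp (fun y => y ^ s)
  have pN : Per N := hN ▸ pM.comp g
  have pA : ∀ i, Per (A i) := fun i => hA ▸ pU.Dd _
  have pL : Per L := hL ▸ Per.sum fun i => (pA i).Dd _
  have posP : ∀ q ∈ Slab T d, 0 < P q := fun q hq => hP ▸ Real.rpow_pos_of_pos (posM q hq) s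
  have dP : ∀ v, ∀ q ∈ Slab T d, Dd v P q = s * M q ^ (s - 1) * Dd v M q := by
    intro v q hq
    rw [hP, Dd_comp (φ := fun y => y ^ s) sM hq
      (Real.differentiableAt_rpow_const_of_ne s (posM q hq).ne')]
    rw [(Real.hasDerivAt_rpow_const (Or.inl (posM q hq).ne')).deriv]
  have dN : ∀ v, ∀ q ∈ Slab T d, Dd v N q = deriv g (M q) * Dd v M q := by
    intro v q hq
    rw [hN, Dd_comp sM hq (gdiff q hq)]
  have dM : ∀ q ∈ Slab T d, Dd (1, 0) M q = ∑ i, (Dd (ex i) M q * A i q) + M q * L q := by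
    intro q hq
    have h1 := hFP q.1 hq.1 q.2
    have h2 : deriv (fun s => m s q.2) q.1 = Dd (1, 0) M q := (time_hasDerivAt sM hq).deriv
    rw [← h2, h1, hL]
    simp only [Finset.mul_sum, ← Finset.sum_add_distrib]
    refine Finset.sum_congr rfl fun i _ => ?_
    have h3 : pd i (u q.1) = fun y => A i (q.1, y) := by
      funext y
      rw [hA]
      exact pd_eq (t := q.1) (x := y) sU ⟨hq.1, trivial⟩ i
    rw [h3]
    have h4 := pd_eq (sM.mul (sA i)) hq i
    rw [← Dd_mul sM (sA i) hq]
    exact h4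
  have dU : ∀ q ∈ Slab T d, Dd (1, 0) U q = (∑ i, A i q * A i q * (1 / 2)) + W q - N q := by
    intro q hq
    have h1 := hHJ q.1 hq.1 q.2
    have h2 : deriv (fun s => u s q.2) q.1 = Dd (1, 0) U q := (time_hasDerivAt sU hq).deriv
    have h3 : ∀ i, pd i (u q.1) q.2 = A i q := by
      intro i
      rw [hA]
      exact pd_eq sU hq i
    have h4 : g (m q.1 q.2) = N q := by rw [hN]
    have h5 : V q.1 q.2 = W q := rfl
    rw [h2, h4, h5] at h1
    simp only [h3] at h1
    rw [← Finset.sum_mul]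
    simp only [← pow_two]
    linarith
  have dPt : ∀ q ∈ Slab T d, Dd (1, 0) P q = ∑ i, Dd (ex i) P q * A i q + s * (P q * L q) := by
    intro q hq
    have hp : M q ^ (s - 1) * M q = P q := by
      rw [hP, ← Real.rpow_add_one (posM q hq).ne']; simp
    rw [dP _ q hq, dM q hq, mul_add, Finset.mul_sum, ← hp]
    congr 1
    · refine Finset.sum_congr rfl fun i _ => ?_
      rw [dP _ q hq]; ring
    · ring
  have dPt' : ∀ q ∈ Slab T d, Dd (1, 0) P q =
      ∑ i, Dd (ex i) (fun q => P q * A i q) q + (s - 1) * (P q * L q) := by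
    intro q hq
    rw [dPt q hq]
    simp only [fun i => Dd_mul (v := ex i) sP (sA i) hq, Finset.sum_add_distrib, ← Finset.mul_sum]
    have : ∑ i, Dd (ex i) (A i) q = L q := by rw [hL]
    rw [this]; ring
  have sPL : Sm T (fun q => P q * L q) := sP.mul sL
  -- first derivative
  have f1 : ∀ t ∈ Set.Ioo 0 T, deriv (fun t' => ∫ x in Set.Icc (0 : Fin d → ℝ) 1, m t' x ^ s) t
      = (s - 1) * ∫ x in Set.Icc (0 : Fin d → ℝ) 1, P (t, x) * L (t, x) := by
    intro t ht
    have h1 := (deriv_int sP ht).deriv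
    have h2 : (fun t' => ∫ x in Set.Icc (0 : Fin d → ℝ) 1, m t' x ^ s) =
      fun t' => ∫ x in Set.Icc (0 : Fin d → ℝ) 1, P (t', x) := by rw [hP]
    rw [h2, h1]
    simp only [fun x => dPt' (t, x) ⟨ht, trivial⟩]
    rw [integral_add, div_int hd (fun i => sP.mul (sA i)) (fun i => pP.mul (pA i)) ht,
      integral_const_mul, zero_add]
    · exact slice_int (Sm.sum fun i => (sP.mul (sA i)).Dd _) ht
    · exact (slice_int sPL ht).const_mul _
  -- second derivative, pointwise
  have lapW : ∀ q ∈ Slab T d, |∑ i, Dd (ex i) (Dd (ex i) W) q| ≤ lapVsup d T V := by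
    intro q hq
    have h1 := lap_le hT V hV hVper (hsub hq).1 q.2
    have h2 : lap (V q.1) q.2 = ∑ i, Dd (ex i) (Dd (ex i) W) q := by
      unfold lap
      refine Finset.sum_congr rfl fun i _ => ?_
      have h3 : pd i (V q.1) = fun y => Dd (ex i) W (q.1, y) := by
        funext y
        exact pd_eq (t := q.1) (x := y) sW ⟨hq.1, trivial⟩ i
      rw [h3]
      exact pd_eq (sW.Dd _) hq i
    rwa [h2] at h1
  have dL : ∀ q ∈ Slab T d, Dd (1, 0) L q = ∑ i, ∑ j, Dd (ex i) (A j) q ^ 2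
      + ∑ j, A j q * Dd (ex j) L q + ∑ i, Dd (ex i) (Dd (ex i) W) q
      - ∑ i, Dd (ex i) (Dd (ex i) N) q := by
    have s0 : Sm T (fun _ : ℝ × (Fin d → ℝ) => (1 / 2 : ℝ)) := contDiffOn_const
    have c1 : ∀ i, ∀ q ∈ Slab T d, Dd (1, 0) (A i) q =
        (∑ j, A j q * Dd (ex i) (A j) q) + Dd (ex i) W q - Dd (ex i) N q := by
      intro i q hq
      have : Dd (1, 0) (A i) q = Dd (ex i) (Dd (1, 0) U) q := by
        rw [hA]; exact Dd_comm sU hq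
      rw [this, Dd_congr dU hq]
      have sAA : ∀ j, Sm T (fun q => A j q * A j q * (1 / 2)) := fun j =>
        ((sA j).mul (sA j)).mul s0
      rw [Dd_sub ((Sm.sum sAA).add sW) sN hq, Dd_add (Sm.sum sAA) sW hq, Dd_sum sAA hq]
      congr 2
      refine Finset.sum_congr rfl fun j _ => ?_
      rw [Dd_mul ((sA j).mul (sA j)) s0 hq, Dd_mul (sA j) (sA j) hq]
      have : Dd (ex i) (fun _ : ℝ × (Fin d → ℝ) => (1 / 2 : ℝ)) q = 0 := by simp [Dd]
      rw [this]; ring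
    have c2 : ∀ i, ∀ q ∈ Slab T d, Dd (1, 0) (Dd (ex i) (A i)) q =
        (∑ j, (Dd (ex i) (A j) q ^ 2 + A j q * Dd (ex j) (Dd (ex i) (A i)) q))
        + Dd (ex i) (Dd (ex i) W) q - Dd (ex i) (Dd (ex i) N) q := by
      intro i q hq
      rw [Dd_comm (sA i) hq, Dd_congr (c1 i) hq]
      have sAA : ∀ j, Sm T (fun q => A j q * Dd (ex i) (A j) q) := fun j =>
        (sA j).mul ((sA j).Dd _)
      rw [Dd_sub ((Sm.sum sAA).add (sW.Dd _)) (sN.Dd _) hq, Dd_add (Sm.sum sAA) (sW.Dd _) hq,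
        Dd_sum sAA hq]
      congr 2
      refine Finset.sum_congr rfl fun j _ => ?_
      rw [Dd_mul (sA j) ((sA j).Dd _) hq]
      have e1 : ∀ q ∈ Slab T d, Dd (ex i) (A j) q = Dd (ex j) (A i) q := by
        intro q hq
        rw [hA]; exact Dd_comm sU hq
      have e2 : Dd (ex i) (Dd (ex i) (A j)) q = Dd (ex j) (Dd (ex i) (A i)) q := by
        rw [Dd_congr e1 hq, Dd_comm (sA i) hq]
      rw [e2]; ring
    intro q hq
    have e3 : ∀ v, Dd v L q = ∑ i, Dd v (Dd (ex i) (A i)) q := by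
      intro v
      rw [hL, Dd_sum (fun i => (sA i).Dd _) hq]
    simp only [e3, Finset.mul_sum]
    rw [Finset.sum_congr rfl fun i _ => c2 i q hq]
    simp only [Finset.sum_sub_distrib, Finset.sum_add_distrib]
    congr 3
    exact Finset.sum_comm
  obtain ⟨H, hH⟩ : ∃ H : Fin d → ℝ × (Fin d → ℝ) → ℝ,
    H = fun i q => P q * A i q * L q - P q * Dd (ex i) N q := ⟨_, rfl⟩
  have sH : ∀ i, Sm T (H i) := fun i =>
    hH ▸ ((sP.mul (sA i)).mul sL).sub (sP.mul (sN.Dd _))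
  have pH : ∀ i, Per (H i) := fun i =>
    hH ▸ ((pP.mul (pA i)).mul pL).sub (pP.mul (pN.Dd _))
  have dPL : ∀ q ∈ Slab T d, ∑ i, Dd (ex i) (H i) q - lapVsup d T V * P q ≤
      Dd (1, 0) (fun q => P q * L q) q := by
    intro q hq
    have hLq : ∑ i, Dd (ex i) (A i) q = L q := by rw [hL]
    have e1 : ∀ i, Dd (ex i) (H i) q = Dd (ex i) P q * A i q * L q
        + P q * L q * Dd (ex i) (A i) q + P q * (A i q * Dd (ex i) L q)
        - Dd (ex i) P q * Dd (ex i) N q - P q * Dd (ex i) (Dd (ex i) N) q := by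
      intro i
      rw [hH]
      simp only
      rw [Dd_sub ((sP.mul (sA i)).mul sL) (sP.mul (sN.Dd _)) hq, Dd_mul (sP.mul (sA i)) sL hq,
        Dd_mul sP (sA i) hq, Dd_mul sP (sN.Dd _) hq]
      ring
    have e2 : 0 ≤ ∑ i, Dd (ex i) P q * Dd (ex i) N q := by
      refine Finset.sum_nonneg fun i _ => ?_
      rw [dP _ q hq, dN _ q hq]
      have h1 := gnn q hq
      have h2 := (Real.rpow_pos_of_pos (posM q hq) (s - 1)).le
      have h3 : 0 ≤ s * M q ^ (s - 1) * deriv g (M q) * (Dd (ex i) M q) ^ 2 := by positivity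
      linarith
    have e3 : 0 ≤ P q * ∑ i, ∑ j, Dd (ex i) (A j) q ^ 2 :=
      mul_nonneg (posP q hq).le
        (Finset.sum_nonneg fun i _ => Finset.sum_nonneg fun j _ => sq_nonneg _)
    have e4 : 0 ≤ (s - 1) * (P q * L q ^ 2) :=
      mul_nonneg (by linarith) (mul_nonneg (posP q hq).le (sq_nonneg _))
    have e5 : -(lapVsup d T V * P q) ≤ P q * ∑ i, Dd (ex i) (Dd (ex i) W) q := by
      have := mul_le_mul_of_nonneg_left (abs_le.1 (lapW q hq)).1 (posP q hq).le
      linarith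
    rw [Dd_mul sP sL hq, dPt q hq, dL q hq]
    simp only [e1, Finset.sum_sub_distrib, Finset.sum_add_distrib, ← Finset.mul_sum,
      ← Finset.sum_mul, hLq]
    linarith
  intro t ht
  have h2 : deriv (deriv (fun t' => ∫ x in Set.Icc (0 : Fin d → ℝ) 1, m t' x ^ s)) t
      = (s - 1) * ∫ x in Set.Icc (0 : Fin d → ℝ) 1, Dd (1, 0) (fun q => P q * L q) (t, x) := by
    have : deriv (fun t' => ∫ x in Set.Icc (0 : Fin d → ℝ) 1, m t' x ^ s) =ᶠ[nhds t]
        fun t => (s - 1) * ∫ x in Set.Icc (0 : Fin d → ℝ) 1, P (t, x) * L (t, x) := by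
      filter_upwards [isOpen_Ioo.mem_nhds ht] with r hr using f1 r hr
    rw [this.deriv_eq]
    exact ((deriv_int sPL ht).const_mul (s - 1)).deriv
  have h3 : ∫ x in Set.Icc (0 : Fin d → ℝ) 1,
        (∑ i, Dd (ex i) (H i) (t, x) - lapVsup d T V * P (t, x)) ≤
      ∫ x in Set.Icc (0 : Fin d → ℝ) 1, Dd (1, 0) (fun q => P q * L q) (t, x) := by
    refine integral_mono ?_ (slice_int (sPL.Dd _) ht) fun x => dPL (t, x) ⟨ht, trivial⟩
    exact (slice_int (Sm.sum fun i => (sH i).Dd _) ht).sub ((slice_int sP ht).const_mul _)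
  rw [integral_sub (slice_int (Sm.sum fun i => (sH i).Dd _) ht) ((slice_int sP ht).const_mul _),
    div_int hd sH pH ht, integral_const_mul] at h3
  have h4 : ∫ x in Set.Icc (0 : Fin d → ℝ) 1, m t x ^ s =
    ∫ x in Set.Icc (0 : Fin d → ℝ) 1, P (t, x) := by rw [hP]
  rw [h2, h4, ge_iff_le]
  have := mul_le_mul_of_nonneg_left h3 (sub_nonneg.2 hs)
  linarith
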